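/- Let k ≥ 2 be an integer, α ∈ (1 − 1/k, 1), ψ ∈ 𝒜, and g ∈ 𝓕. Then lim_{κ→0⁺} ∫_{ℝ^k} |ψ̂(x₁ + … + x_k)|² · |ĝ(κ(x₁ + … + x_k)) − 1|² · |x₁|^{−α} ⋯ |x_k|^{−α} dx₁ … dx_k = 0. -/

import Mathlib

open MeasureTheory Filter Set
open scoped ENNReal

/-- The class `𝒜` of finite linear combinations of indicators of bounded intervals. -/
def memA (ψ : ℝ → ℝ) : Prop :=
  ∃ (m : ℕ) (a : Fin m → ℝ) (I : Fin m → Set ℝ),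
    (∀ j, (I j).OrdConnected ∧ Bornology.IsBounded (I j)) ∧
    ∀ x, ψ x = ∑ j, a j * (I j).indicator (fun _ => (1 : ℝ)) x

/-- The class `𝓕`: nonnegative, even, smooth functions supported in the open unit ball with
integral one. -/
def memF (f : ℝ → ℝ) : Prop :=
  (∀ x, 0 ≤ f x) ∧ (∀ x, f (-x) = f x) ∧ ContDiff ℝ (⊤ : ℕ∞) f ∧
    Function.support f ⊆ Metric.ball (0 : ℝ) 1 ∧ (∫ x, f x) = 1

/-- The Fourier transform `ĝ(x) = ∫ e^{ixz} g(z) dz`. -/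
noncomputable def ft (g : ℝ → ℂ) (x : ℝ) : ℂ :=
  ∫ z : ℝ, Complex.exp (Complex.I * x * z) * g z

/-- The weight `|x| ^ (-γ)` with values in `ℝ≥0∞`. -/
noncomputable def rieszWeight (γ x : ℝ) : ℝ≥0∞ := ENNReal.ofReal (|x| ^ (-γ))

@[fun_prop]
theorem measurable_rieszWeight (γ : ℝ) : Measurable (rieszWeight γ) := by
  unfold rieszWeight
  fun_prop

theorem rieszWeight_mul (γ x y : ℝ) :
    rieszWeight γ (x * y) = rieszWeight γ x * rieszWeight γ y := by
  unfold rieszWeight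
  rw [abs_mul, Real.mul_rpow (abs_nonneg _) (abs_nonneg _), ENNReal.ofReal_mul (by positivity)]

theorem lintegral_rieszWeight_mul_one_add_abs_lt_top {α β : ℝ} (hα : 0 ≤ α) (hα1 : α < 1)
    (hβ : 0 ≤ β) (hαβ : 1 < α + β) :
    ∫⁻ x, rieszWeight α x * ENNReal.ofReal ((1 + |x|) ^ (-β)) < ∞ := by
  have hloc : ∫⁻ x in Metric.ball (0 : ℝ) 1, rieszWeight α x < ∞ := by
    have h : IntegrableOn (fun x : ℝ => |x| ^ (-α)) (Metric.ball 0 1) :=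
      integrableOn_ball_of_norm_le_rpow (C := 1) (α := α) (by simp) (by simpa using hα1)
        (.of_forall fun x => by
          rw [Real.norm_of_nonneg (by positivity), one_mul, Real.norm_eq_abs])
        (by fun_prop : Measurable fun x : ℝ => |x| ^ (-α)).aestronglyMeasurable
    exact h.lintegral_lt_top
  have hfar : ∫⁻ x : ℝ, ENNReal.ofReal (2 ^ α * (1 + |x|) ^ (-(α + β))) < ∞ := by
    have h : Integrable (fun x : ℝ => (1 + ‖x‖) ^ (-(α + β))) :=
      integrable_one_add_norm (by simpa using hαβ)
    exact (h.const_mul (2 ^ α)).lintegral_lt_top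
  calc
    _ ≤ ∫⁻ x : ℝ, ((Metric.ball (0 : ℝ) 1).indicator (rieszWeight α) x +
          ENNReal.ofReal (2 ^ α * (1 + |x|) ^ (-(α + β)))) := by
      refine lintegral_mono fun x => ?_
      have h1 : 1 ≤ 1 + |x| := by linarith [abs_nonneg x]
      by_cases hx : |x| < 1
      · rw [indicator_of_mem (by simpa using hx)]
        refine le_trans ?_ le_self_add
        refine mul_le_of_le_one_right' ?_
        exact ENNReal.ofReal_le_one.2 (Real.rpow_le_one_of_one_le_of_nonpos h1 (neg_nonpos.2 hβ))
      · refine le_trans ?_ le_add_self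
        push Not at hx
        rw [rieszWeight, ← ENNReal.ofReal_mul (by positivity)]
        refine ENNReal.ofReal_le_ofReal ?_
        rw [neg_add, Real.rpow_add (by linarith), ← mul_assoc]
        gcongr
        have : |x| ^ (-α) ≤ ((1 + |x|) / 2) ^ (-α) :=
          Real.rpow_le_rpow_of_nonpos (by linarith) (by linarith) (by linarith)
        refine this.trans_eq ?_
        rw [Real.div_rpow (by linarith) (by norm_num), Real.rpow_neg two_pos.le]
        field_simp
    _ < ∞ := by
      rw [lintegral_add_left ((measurable_rieszWeight α).indicator Metric.isOpen_ball.measurableSet),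
        lintegral_indicator Metric.isOpen_ball.measurableSet]
      exact ENNReal.add_lt_top.2 ⟨hloc, hfar⟩

theorem rieszWeight_le_one_add_abs {γ x y : ℝ} (hγ : 0 ≤ γ) (hxy : |x| ≤ |y|)
    (h1 : 1 ≤ |x| + |y|) :
    rieszWeight γ y ≤ ENNReal.ofReal (3 ^ γ) * ENNReal.ofReal ((1 + |x|) ^ (-γ)) := by
  rw [rieszWeight, ← ENNReal.ofReal_mul (by positivity)]
  refine ENNReal.ofReal_le_ofReal ?_
  have hx := abs_nonneg x
  have : |y| ^ (-γ) ≤ ((1 + |x|) / 3) ^ (-γ) :=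
    Real.rpow_le_rpow_of_nonpos (by linarith) (by linarith) (by linarith)
  refine this.trans_eq ?_
  rw [Real.div_rpow (by linarith) (by norm_num), Real.rpow_neg (by norm_num : (0 : ℝ) ≤ 3)]
  field_simp

theorem lintegral_rieszWeight_mul_one_sub_lt_top {α β : ℝ} (hα : 0 ≤ α) (hα1 : α < 1)
    (hβ : 0 ≤ β) (hβ1 : β < 1) (hαβ : 1 < α + β) :
    ∫⁻ x, rieszWeight α x * rieszWeight β (1 - x) < ∞ := by
  set P : ℝ → ℝ≥0∞ := fun x => rieszWeight α x * ENNReal.ofReal ((1 + |x|) ^ (-β))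
  set Q : ℝ → ℝ≥0∞ := fun x => rieszWeight β x * ENNReal.ofReal ((1 + |x|) ^ (-α))
  have hP : ∫⁻ x, P x < ∞ := lintegral_rieszWeight_mul_one_add_abs_lt_top hα hα1 hβ hαβ
  have hQ : ∫⁻ x, Q x < ∞ :=
    lintegral_rieszWeight_mul_one_add_abs_lt_top hβ hβ1 hα (by linarith)
  have hPm : Measurable P := by fun_prop
  have hQm : Measurable Q := by fun_prop
  calc
    _ ≤ ∫⁻ x, (ENNReal.ofReal (3 ^ β) * P x + ENNReal.ofReal (3 ^ α) * Q (1 - x)) := by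
      refine lintegral_mono fun x => ?_
      have h1 : 1 ≤ |x| + |1 - x| := by
        linarith [le_abs_self x, le_abs_self (1 - x)]
      rcases le_total |x| |1 - x| with h | h
      · refine le_trans ?_ le_self_add
        calc
          _ ≤ rieszWeight α x *
              (ENNReal.ofReal (3 ^ β) * ENNReal.ofReal ((1 + |x|) ^ (-β))) := by
            gcongr
            exact rieszWeight_le_one_add_abs hβ h h1
          _ = _ := by simp only [P]; ring
      · refine le_trans ?_ le_add_self
        calc
          _ ≤ (ENNReal.ofReal (3 ^ α) * ENNReal.ofReal ((1 + |1 - x|) ^ (-α))) *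
              rieszWeight β (1 - x) := by
            gcongr
            exact rieszWeight_le_one_add_abs hα h (by linarith)
          _ = _ := by simp only [Q]; ring
    _ < ∞ := by
      rw [lintegral_add_left (by fun_prop), lintegral_const_mul _ hPm,
        lintegral_const_mul _ (by fun_prop), lintegral_sub_left_eq_self]
      exact ENNReal.add_lt_top.2 ⟨ENNReal.mul_lt_top ENNReal.ofReal_lt_top hP,
        ENNReal.mul_lt_top ENNReal.ofReal_lt_top hQ⟩

theorem lintegral_rieszWeight_mul_sub {α β s : ℝ} (hs : s ≠ 0) :
    ∫⁻ x, rieszWeight α x * rieszWeight β (s - x) =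
      (∫⁻ x, rieszWeight α x * rieszWeight β (1 - x)) * rieszWeight (α + β - 1) s := by
  have h0 : 0 < |s| := abs_pos.2 hs
  have hw : ENNReal.ofReal |s| * (rieszWeight α s * rieszWeight β s) =
      rieszWeight (α + β - 1) s := by
    unfold rieszWeight
    rw [← ENNReal.ofReal_mul (by positivity), ← ENNReal.ofReal_mul (by positivity),
      ← Real.rpow_add h0]
    nth_rewrite 1 [← Real.rpow_one |s|]
    rw [← Real.rpow_add h0]
    congr 2
    ring
  have hm : Measurable fun x => rieszWeight α x * rieszWeight β (s - x) := by fun_prop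
  rw [← Real.smul_map_volume_mul_left hs, lintegral_smul_measure,
    lintegral_map hm (measurable_const_mul s), Real.smul_map_volume_mul_left hs, smul_eq_mul,
    mul_comm _ (rieszWeight (α + β - 1) s), ← hw, mul_assoc]
  congr 1
  rw [← lintegral_const_mul _ (by fun_prop)]
  refine lintegral_congr fun x => ?_
  rw [show s - s * x = s * (1 - x) by ring, rieszWeight_mul, rieszWeight_mul]
  ring

theorem exists_lintegral_sum_mul_prod_rieszWeight_le {α : ℝ} (hα1 : α < 1) (n : ℕ)
    (hα : n < (n + 1) * α) :
    ∃ C : ℝ≥0∞, C ≠ ∞ ∧ ∀ F : ℝ → ℝ≥0∞, Measurable F →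
      ∫⁻ x : Fin (n + 1) → ℝ, F (∑ i, x i) * ∏ i, rieszWeight α (x i) ≤
        C * ∫⁻ s, F s * rieszWeight ((n + 1) * α - n) s := by
  induction n with
  | zero =>
    refine ⟨1, by simp, fun F hF => ?_⟩
    have h := (volume_preserving_funUnique (Fin 1) ℝ).lintegral_comp_emb
      (MeasurableEquiv.measurableEmbedding _) (fun s => F s * rieszWeight α s)
    simp only [MeasurableEquiv.funUnique_apply, Fin.default_eq_zero] at h
    refine le_of_eq ?_
    convert h using 1
    · simp
      congr!
    · simp
  | succ n ih =>
    push_cast at hα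
    have hβ : n < (n + 1) * α := by linarith
    obtain ⟨C, hC, hCF⟩ := ih hβ
    set β : ℝ := (n + 1) * α - n with hβdef
    have hα0 : 0 ≤ α := by
      by_contra! h
      have : ((n : ℝ) + 1) * α ≤ 0 := mul_nonpos_of_nonneg_of_nonpos (by positivity) h.le
      linarith [(n.cast_nonneg : (0 : ℝ) ≤ n)]
    have hn : (0 : ℝ) ≤ n := n.cast_nonneg
    have hK := lintegral_rieszWeight_mul_one_sub_lt_top (α := α) (β := β) hα0 hα1
      (by linarith) (by nlinarith) (by linarith)
    set K := ∫⁻ x, rieszWeight α x * rieszWeight β (1 - x)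
    refine ⟨C * K, ENNReal.mul_ne_top hC hK.ne, fun F hF => ?_⟩
    have hpres := (volume_preserving_piFinSuccAbove (fun _ : Fin (n + 2) => ℝ) 0).symm
    rw [← hpres.lintegral_comp (by fun_prop), Measure.volume_eq_prod,
      lintegral_prod _ (by fun_prop)]
    calc
      _ = ∫⁻ a, rieszWeight α a * ∫⁻ y : Fin (n + 1) → ℝ,
            F (a + ∑ i, y i) * ∏ i, rieszWeight α (y i) := by
        refine lintegral_congr fun a => ?_
        rw [← lintegral_const_mul _ (by fun_prop)]
        refine lintegral_congr fun y => ?_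
        simp [Fin.sum_univ_succ, Fin.prod_univ_succ, MeasurableEquiv.piFinSuccAbove_symm_apply]
        ring
      _ ≤ ∫⁻ a, rieszWeight α a * (C * ∫⁻ s, F (a + s) * rieszWeight β s) := by
        gcongr with a
        exact hCF (fun t => F (a + t)) (by fun_prop)
      _ = C * ∫⁻ a, ∫⁻ t, F t * (rieszWeight α a * rieszWeight β (t - a)) := by
        rw [← lintegral_const_mul' _ _ hC]
        refine lintegral_congr fun a => ?_
        rw [← lintegral_add_left_eq_self (fun t => F t * (rieszWeight α a * rieszWeight β (t - a))) a,
          mul_left_comm, ← lintegral_const_mul _ (by fun_prop)]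
        congr 1
        refine lintegral_congr fun s => ?_
        rw [add_sub_cancel_left]
        ring
      _ = C * ∫⁻ t, F t * ∫⁻ a, rieszWeight α a * rieszWeight β (t - a) := by
        rw [lintegral_lintegral_swap (by fun_prop)]
        congr 1
        refine lintegral_congr fun t => ?_
        rw [lintegral_const_mul _ (by fun_prop)]
      _ = C * ∫⁻ t, F t * (K * rieszWeight (α + β - 1) t) := by
        congr 1
        refine lintegral_congr_ae ?_
        filter_upwards [compl_mem_ae_iff.2 (measure_singleton (0 : ℝ))] with t ht
        rw [lintegral_rieszWeight_mul_sub ht]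
      _ = _ := by
        rw [mul_assoc]
        congr 1
        rw [← lintegral_const_mul _ (by fun_prop)]
        refine lintegral_congr fun t => ?_
        rw [mul_left_comm]
        congr 3
        rw [hβdef]
        push_cast
        ring

theorem continuous_ft {f : ℝ → ℂ} (hf : Integrable f) : Continuous (ft f) := by
  unfold ft
  refine continuous_of_dominated (bound := fun z => ‖f z‖) (fun x => ?_) (fun x => ?_) hf.norm ?_
  · exact (by fun_prop : Continuous fun z : ℝ =>
      Complex.exp (Complex.I * x * z)).aestronglyMeasurable.mul hf.1
  · refine .of_forall fun z => ?_
    rw [norm_mul, mul_assoc, mul_comm, mul_comm Complex.I, ← Complex.ofReal_mul,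
      Complex.norm_exp_ofReal_mul_I, mul_one]
  · exact .of_forall fun z => by fun_prop

theorem norm_ft_le (f : ℝ → ℂ) (x : ℝ) : ‖ft f x‖ ≤ ∫ z, ‖f z‖ := by
  refine (norm_integral_le_integral_norm _).trans_eq (integral_congr_ae (.of_forall fun z => ?_))
  simp only
  rw [norm_mul, mul_assoc, mul_comm, mul_comm Complex.I, ← Complex.ofReal_mul,
    Complex.norm_exp_ofReal_mul_I, mul_one]

theorem Set.OrdConnected.exists_ae_eq_Ioc {I : Set ℝ} (hI : I.OrdConnected)
    (hb : Bornology.IsBounded I) : ∃ a b : ℝ, a ≤ b ∧ I =ᵐ[volume] Ioc a b := by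
  rcases I.eq_empty_or_nonempty with rfl | hne
  · exact ⟨0, 0, le_rfl, by simp⟩
  have hlow : Ioo (sInf I) (sSup I) ⊆ I :=
    IsConnected.Ioo_csInf_csSup_subset ⟨hne, hI.isPreconnected⟩ hb.bddBelow hb.bddAbove
  have hup : I ⊆ Icc (sInf I) (sSup I) := subset_Icc_csInf_csSup hb.bddBelow hb.bddAbove
  refine ⟨sInf I, sSup I, Real.sInf_le_sSup I hb.bddBelow hb.bddAbove, ?_⟩
  refine Filter.EventuallyLE.antisymm ?_ ?_
  · exact (LE.le.eventuallyLE hup).trans Ioc_ae_eq_Icc.symm.le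
  · exact Ioo_ae_eq_Ioc.symm.le.trans (LE.le.eventuallyLE hlow)

theorem exists_norm_ft_indicator_le {I : Set ℝ} (hI : I.OrdConnected)
    (hb : Bornology.IsBounded I) :
    ∃ C : ℝ, ∀ x, ‖ft (I.indicator fun _ => 1) x‖ ≤ C * (1 + |x|)⁻¹ := by
  obtain ⟨a, b, hab, hIab⟩ := hI.exists_ae_eq_Ioc hb
  have hft (x : ℝ) : ft (I.indicator fun _ => 1) x =
      ∫ z in a..b, Complex.exp (Complex.I * x * z) := by
    rw [ft, intervalIntegral.integral_of_le hab, ← integral_indicator measurableSet_Ioc]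
    refine integral_congr_ae ?_
    filter_upwards [indicator_ae_eq_of_ae_eq_set (f := fun _ => (1 : ℂ)) hIab] with z hz
    rw [hz]
    by_cases h : z ∈ Ioc a b <;> simp [h]
  have hexp (x z : ℝ) : ‖Complex.exp (Complex.I * x * z)‖ = 1 := by
    rw [mul_assoc, mul_comm, ← Complex.ofReal_mul, Complex.norm_exp_ofReal_mul_I]
  refine ⟨(b - a) + 2, fun x => ?_⟩
  rw [hft, ← div_eq_mul_inv, le_div_iff₀ (by positivity), mul_add, mul_one]
  refine add_le_add ?_ ?_
  · have := intervalIntegral.norm_integral_le_of_norm_le_const (a := a) (b := b) (C := 1)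
      (f := fun z : ℝ => Complex.exp (Complex.I * x * z)) fun z _ => (hexp x z).le
    rwa [one_mul, abs_of_nonneg (sub_nonneg.2 hab)] at this
  · rcases eq_or_ne x 0 with rfl | hx
    · simp
    have hc : Complex.I * x ≠ 0 := by simp [hx]
    rw [integral_exp_mul_complex hc, norm_div, norm_mul, Complex.norm_I, one_mul,
      Complex.norm_real, Real.norm_eq_abs, div_mul_cancel₀ _ (abs_ne_zero.2 hx)]
    refine (norm_sub_le _ _).trans_eq ?_
    rw [hexp, hexp]
    norm_num

theorem integrable_const_indicator_of_ordConnected {E : Type*} [NormedAddCommGroup E] {I : Set ℝ}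
    (hI : I.OrdConnected) (hb : Bornology.IsBounded I) (c : E) :
    Integrable (I.indicator fun _ => c) :=
  (integrable_indicator_iff hI.measurableSet).2 (integrableOn_const hb.measure_lt_top.ne)

theorem memA.integrable {ψ : ℝ → ℝ} (hψ : memA ψ) : Integrable ψ := by
  obtain ⟨m, a, I, hI, h⟩ := hψ
  rw [funext h]
  exact integrable_finsetSum _ fun j _ =>
    ((integrable_const_indicator_of_ordConnected (hI j).1 (hI j).2 (1 : ℝ)).const_mul _)

theorem memA.exists_norm_ft_le {ψ : ℝ → ℝ} (hψ : memA ψ) :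
    ∃ C : ℝ, ∀ x, ‖ft (fun z => (ψ z : ℂ)) x‖ ≤ C * (1 + |x|)⁻¹ := by
  obtain ⟨m, a, I, hI, h⟩ := hψ
  choose C hC using fun j => exists_norm_ft_indicator_le (hI j).1 (hI j).2
  refine ⟨∑ j, |a j| * C j, fun x => ?_⟩
  have hft : ft (fun z => (ψ z : ℂ)) x = ∑ j, (a j : ℂ) * ft ((I j).indicator fun _ => 1) x := by
    simp only [ft, ← integral_const_mul]
    rw [← integral_finsetSum]
    · refine integral_congr_ae (.of_forall fun z => ?_)
      simp only [h, Complex.ofReal_sum, Finset.mul_sum]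
      refine Finset.sum_congr rfl fun j _ => ?_
      by_cases hz : z ∈ I j <;> simp [hz, mul_comm]
    · refine fun j _ => Integrable.const_mul ?_ _
      refine (integrable_const_indicator_of_ordConnected (hI j).1 (hI j).2 (1 : ℂ)).bdd_mul
        (c := 1) (by fun_prop) (.of_forall fun z => ?_)
      rw [mul_assoc, mul_comm, ← Complex.ofReal_mul, Complex.norm_exp_ofReal_mul_I]
  rw [hft, Finset.sum_mul]
  refine norm_sum_le_of_le _ fun j _ => ?_
  rw [norm_mul, Complex.norm_real, Real.norm_eq_abs, mul_assoc]
  gcongr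
  exact hC j x

theorem memF.integrable {g : ℝ → ℝ} (hg : memF g) : Integrable g :=
  .of_integral_ne_zero (by rw [hg.2.2.2.2]; exact one_ne_zero)

theorem memF.ft_zero {g : ℝ → ℝ} (hg : memF g) : ft (fun z => (g z : ℂ)) 0 = 1 := by
  simp [ft, integral_complex_ofReal, hg.2.2.2.2]

theorem memF.norm_ft_le_one {g : ℝ → ℝ} (hg : memF g) (x : ℝ) :
    ‖ft (fun z => (g z : ℂ)) x‖ ≤ 1 := by
  refine (norm_ft_le _ x).trans_eq ?_
  rw [← hg.2.2.2.2]
  refine integral_congr_ae (.of_forall fun z => ?_)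
  simp [abs_of_nonneg (hg.1 z)]

theorem stmt14 (k : ℕ) (hk : 2 ≤ k) (α : ℝ) (hα : α ∈ Set.Ioo (1 - 1 / (k : ℝ)) 1)
    (ψ : ℝ → ℝ) (hψ : memA ψ) (g : ℝ → ℝ) (hg : memF g) :
    Tendsto
      (fun κ : ℝ =>
        ∫⁻ x : Fin k → ℝ,
          ENNReal.ofReal
            (‖ft (fun z => (ψ z : ℂ)) (∑ i, x i)‖ ^ 2 *
              ‖ft (fun z => (g z : ℂ)) (κ * ∑ i, x i) - 1‖ ^ 2 * ∏ i, |x i| ^ (-α)))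
      (nhdsWithin 0 (Set.Ioi 0)) (nhds 0) := by
  have hψc : Continuous (ft fun z => (ψ z : ℂ)) := continuous_ft hψ.integrable.ofReal
  have hgc : Continuous (ft fun z => (g z : ℂ)) := continuous_ft hg.integrable.ofReal
  obtain ⟨n, rfl⟩ : ∃ n, k = n + 1 := ⟨k - 1, by omega⟩
  obtain ⟨C, hC⟩ := hψ.exists_norm_ft_le
  obtain ⟨hα0, hα1⟩ := hα
  have hn : (0 : ℝ) ≤ n := n.cast_nonneg
  have hαn : n < (n + 1) * α := by
    push_cast at hα0
    have : ((n : ℝ) + 1) * (1 - 1 / (n + 1)) < (n + 1) * α := by gcongr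
    rwa [mul_sub, mul_one_div_cancel (by positivity), mul_one, add_sub_cancel_right] at this
  set F : ℝ → ℝ≥0∞ := fun s => ENNReal.ofReal (4 * C ^ 2) * ENNReal.ofReal ((1 + |s|) ^ (-2 : ℝ))
    with hF
  have hFm : Measurable F := by fun_prop
  have hfin : ∫⁻ x : Fin (n + 1) → ℝ, F (∑ i, x i) * ∏ i, rieszWeight α (x i) ≠ ∞ := by
    obtain ⟨K, hK, hKF⟩ := exists_lintegral_sum_mul_prod_rieszWeight_le hα1 n hαn
    refine ((hKF F hFm).trans_lt (ENNReal.mul_lt_top hK.lt_top ?_)).ne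
    simp only [hF, mul_assoc]
    rw [lintegral_const_mul _ (by fun_prop)]
    refine ENNReal.mul_lt_top ENNReal.ofReal_lt_top ?_
    simp only [mul_comm (ENNReal.ofReal _)]
    exact lintegral_rieszWeight_mul_one_add_abs_lt_top (by linarith) (by nlinarith) (by norm_num)
      (by linarith)
  rw [← lintegral_zero (μ := (volume : Measure (Fin (n + 1) → ℝ)))]
  refine tendsto_lintegral_filter_of_dominated_convergence
    (fun x => F (∑ i, x i) * ∏ i, rieszWeight α (x i)) ?_ ?_ hfin ?_
  · refine .of_forall fun κ => ?_
    have h1 := hψc.measurable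
    have h2 := hgc.measurable
    fun_prop
  · refine .of_forall fun κ => .of_forall fun x => ?_
    simp only [hF, rieszWeight]
    rw [← ENNReal.ofReal_prod_of_nonneg fun i _ => by positivity,
      ← ENNReal.ofReal_mul (by positivity), ← ENNReal.ofReal_mul (by positivity)]
    refine ENNReal.ofReal_le_ofReal ?_
    have hgle : ‖ft (fun z => (g z : ℂ)) (κ * ∑ i, x i) - 1‖ ≤ 2 := by
      refine (norm_sub_le _ _).trans ?_
      rw [norm_one]
      linarith [hg.norm_ft_le_one (κ * ∑ i, x i)]
    have h2 : (1 + |∑ i, x i|) ^ (-2 : ℝ) = ((1 + |∑ i, x i|)⁻¹) ^ 2 := by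
      rw [Real.rpow_neg (by positivity), inv_pow]
      norm_num
    rw [h2]
    refine mul_le_mul_of_nonneg_right ?_ (Finset.prod_nonneg fun i _ => by positivity)
    calc
      _ ≤ (C * (1 + |∑ i, x i|)⁻¹) ^ 2 * 2 ^ 2 := by
        gcongr
        exact hC _
      _ = _ := by ring
  · refine .of_forall fun x => ?_
    have hcont : Continuous fun κ : ℝ => ENNReal.ofReal
        (‖ft (fun z => (ψ z : ℂ)) (∑ i, x i)‖ ^ 2 *
          ‖ft (fun z => (g z : ℂ)) (κ * ∑ i, x i) - 1‖ ^ 2 * ∏ i, |x i| ^ (-α)) :=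
      ENNReal.continuous_ofReal.comp (by fun_prop)
    have h := hcont.tendsto 0
    simp only [zero_mul, hg.ft_zero, sub_self, norm_zero, ne_eq, OfNat.ofNat_ne_zero,
      not_false_eq_true, zero_pow, mul_zero, ENNReal.ofReal_zero] at h
    exact h.mono_left nhdsWithin_le_nhds
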